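/- Let H be a near-triangulation whose outer face is bounded by a 5-cycle R = v₁v₂v₃v₄v₅, given with a proper 4-coloring of H in which exactly three colors appear on R. Then, using at most six single Kempe changes in H, one can either (i) find j ∈ {1,…,5} and produce all four 4-colorings (up to permutation of colors) of R in which v_j is the only vertex of its color, or (ii) find j ∈ {1,…,5} and produce all three 4-colorings of R in which v_j and v_{j+2} (index taken modulo 5) receive the same color, or (iii) produce all five 3-colorings of R; moreover, this can be done in time linear in the size of H. -/

import Mathlib

/-!
Common formal framework for statements from
"A near-linear time 4-coloring algorithm for planar graphs".

Plane embeddings are modelled combinatorially by rotation systems on darts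
(Heffter–Edmonds): a graph together with a rotation system embeds in the
orientable surface whose faces are the orbits of the face-tracing permutation,
and the embedding is in the 2-sphere precisely when Euler's relation holds.
-/

namespace FourColor

open SimpleGraph

/-- Degree of a vertex, as the cardinality of its neighbour set. -/
noncomputable def vdeg {V : Type} (G : SimpleGraph V) (v : V) : ℕ :=
  (G.neighborSet v).ncard

/-- Dart reversal, as a permutation of the darts of a graph. -/
def dartRev {V : Type} (G : SimpleGraph V) : Equiv.Perm G.Dart where
  toFun := SimpleGraph.Dart.symm
  invFun := SimpleGraph.Dart.symm
  left_inv d := SimpleGraph.Dart.symm_symm d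
  right_inv d := SimpleGraph.Dart.symm_symm d

/-- A combinatorial embedding (rotation system) of a graph: a permutation of the
darts fixing tails, whose restriction to the darts out of each vertex is a
single cycle (the clockwise rotation around the vertex). -/
structure CombEmbedding {V : Type} (G : SimpleGraph V) where
  rot : Equiv.Perm G.Dart
  rot_fst : ∀ d : G.Dart, (rot d).toProd.1 = d.toProd.1
  rot_cyclic : ∀ d d' : G.Dart, d.toProd.1 = d'.toProd.1 → ∃ n : ℕ, (rot ^ n) d = d'

namespace CombEmbedding

variable {V : Type} {G : SimpleGraph V}

/-- The face-tracing permutation of an embedding. -/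
def facePerm (E : CombEmbedding G) : Equiv.Perm G.Dart :=
  (dartRev G).trans E.rot

/-- Two darts lie on the same face iff they are in the same orbit of the
face-tracing permutation. -/
def faceSetoid (E : CombEmbedding G) : Setoid G.Dart where
  r d d' := ∃ n : ℤ, (E.facePerm ^ n) d = d'
  iseqv := by
    refine ⟨fun d => ⟨0, by simp⟩, ?_, ?_⟩
    · rintro d d' ⟨n, h⟩
      refine ⟨-n, ?_⟩
      rw [← h, ← Equiv.Perm.mul_apply, ← zpow_add, neg_add_cancel, zpow_zero,
        Equiv.Perm.one_apply]
    · rintro a b c ⟨m, h1⟩ ⟨n, h2⟩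
      refine ⟨n + m, ?_⟩
      rw [← h2, ← h1, ← Equiv.Perm.mul_apply, ← zpow_add]

/-- The number of faces of an embedding. -/
noncomputable def numFaces (E : CombEmbedding G) : ℕ :=
  Nat.card (Quotient E.faceSetoid)

/-- Euler's relation characterising embeddings of a (possibly disconnected)
finite graph in the 2-sphere: `V - E + F = 2·(#components) - (#isolated vertices)`. -/
def IsSpherical [Fintype V] (E : CombEmbedding G) : Prop :=
  (Fintype.card V : ℤ) - (G.edgeSet.ncard : ℤ) + (E.numFaces : ℤ) =
    2 * (Nat.card G.ConnectedComponent : ℤ) - (({v : V | ∀ w, ¬ G.Adj v w}).ncard : ℤ)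

end CombEmbedding

/-- A finite simple graph is planar iff it admits a rotation system
satisfying Euler's relation for the sphere. -/
def IsPlanar {V : Type} [Fintype V] (G : SimpleGraph V) : Prop :=
  ∃ E : CombEmbedding G, E.IsSpherical

/-- A planar triangulation: a connected simple graph embedded in the 2-sphere
(Euler's relation) all of whose faces are triangles. -/
structure PlaneTriangulation (V : Type) [Fintype V] where
  graph : SimpleGraph V
  emb : CombEmbedding graph
  conn : graph.Connected
  euler : (Fintype.card V : ℤ) - (graph.edgeSet.ncard : ℤ) + (emb.numFaces : ℤ) = 2
  faces_tri : ∀ d : graph.Dart, (emb.facePerm ^ 3) d = d ∧ emb.facePerm d ≠ d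

/-- A near-triangulation: a connected plane graph, with a designated outer face,
all of whose faces except the outer one are triangles.  (The trivial
near-triangulations on a single vertex are allowed.) -/
structure NearTriangulation (V : Type) [Fintype V] where
  graph : SimpleGraph V
  emb : CombEmbedding graph
  conn : graph.Connected
  euler : Fintype.card V = 1 ∨
    (Fintype.card V : ℤ) - (graph.edgeSet.ncard : ℤ) + (emb.numFaces : ℤ) = 2
  /-- membership of a dart in the (boundary walk of the) outer face -/
  isOuter : graph.Dart → Prop
  outer_closed : ∀ d, isOuter d → isOuter (emb.facePerm d)
  outer_single : ∀ d d', isOuter d → isOuter d' → ∃ n : ℕ, (emb.facePerm ^ n) d = d'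
  outer_nonempty : ∀ _ : graph.Dart, ∃ d', isOuter d'
  inner_tri : ∀ d, ¬ isOuter d → (emb.facePerm ^ 3) d = d ∧ emb.facePerm d ≠ d

namespace NearTriangulation

variable {V : Type} [Fintype V]

/-- A vertex lies on the outer face boundary. -/
def OnOuter (N : NearTriangulation V) (v : V) : Prop :=
  IsEmpty N.graph.Dart ∨ ∃ d : N.graph.Dart, N.isOuter d ∧ d.toProd.1 = v

/-- An edge lies on the outer face boundary. -/
def IsOuterEdge (N : NearTriangulation V) (x y : V) : Prop :=
  ∃ d : N.graph.Dart, N.isOuter d ∧ (d.toProd = (x, y) ∨ d.toProd = (y, x))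

end NearTriangulation

/-- `v` is a cut-vertex of `G`: deleting it increases the number of
connected components. -/
def IsCutVertex {V : Type} (G : SimpleGraph V) (v : V) : Prop :=
  Nat.card G.ConnectedComponent <
    Nat.card (G.induce {w : V | w ≠ v}).ConnectedComponent

/-- A configuration `(Z, δ)`: a near-triangulation together with a degree
function which agrees with the degree at interior vertices, exceeds it at
outer vertices, and with at most one cut-vertex, lying in exactly two blocks
and having external degree 2. -/
structure Configuration (V : Type) [Fintype V] extends NearTriangulation V where
  δ : V → ℕ
  delta_inner : ∀ v : V, ¬ toNearTriangulation.OnOuter v → δ v = vdeg graph v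
  delta_outer : ∀ v : V, toNearTriangulation.OnOuter v → vdeg graph v < δ v
  cut_unique : ∀ u w : V, IsCutVertex graph u → IsCutVertex graph w → u = w
  cut_cond : ∀ v : V, IsCutVertex graph v →
    Nat.card (graph.induce {w : V | w ≠ v}).ConnectedComponent = 2 ∧
    δ v = vdeg graph v + 2

/-- The map induced on darts by an adjacency-preserving vertex map. -/
def dartMap {A V : Type} {ZG : SimpleGraph A} {G : SimpleGraph V} (f : A → V)
    (h : ∀ ⦃a b : A⦄, ZG.Adj a b → G.Adj (f a) (f b)) (d : ZG.Dart) : G.Dart :=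
  ⟨(f d.toProd.1, f d.toProd.2), h d.adj⟩

/-- An orientation-preserving homomorphism of a configuration into a plane
triangulation: adjacency-preserving, sending inner facial triangles to facial
triangles with the same orientation, and matching the prescribed degrees. -/
def IsConfigHomMap {A V : Type} [Fintype A] [Fintype V] (C : Configuration A)
    (T : PlaneTriangulation V) (f : A → V) : Prop :=
  ∃ h : ∀ ⦃a b : A⦄, C.graph.Adj a b → T.graph.Adj (f a) (f b),
    (∀ v : A, vdeg T.graph (f v) = C.δ v) ∧
    (∀ d : C.graph.Dart, ¬ C.isOuter d →
      T.emb.facePerm (dartMap f h d) = dartMap f h (C.emb.facePerm d))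

/-- `f` exhibits the configuration `C` as being contained in the plane
triangulation `T`: an injective orientation-preserving homomorphism matching
degrees; moreover at a cut-vertex the two incident edges of `T` not coming
from `C` are non-consecutive in the rotation. -/
def IsContainMap {A V : Type} [Fintype A] [Fintype V] (C : Configuration A)
    (T : PlaneTriangulation V) (f : A → V) : Prop :=
  Function.Injective f ∧ IsConfigHomMap C T f ∧
  ∀ v : A, IsCutVertex C.graph v →
    ∀ e e' : T.graph.Dart, e.toProd.1 = f v → e'.toProd.1 = f v →
      (¬ ∃ a b : A, C.graph.Adj a b ∧ e.toProd = (f a, f b)) →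
      (¬ ∃ a b : A, C.graph.Adj a b ∧ e'.toProd = (f a, f b)) →
      e ≠ e' → T.emb.rot e ≠ e'

/-- A configuration on a concrete finite vertex set. -/
def ConfigOn : Type := Σ n : ℕ, Configuration (Fin n)

/-- The configuration `C` is contained in `T` within the set `S` of vertices. -/
def ConfigOn.ContainedIn (C : ConfigOn) {V : Type} [Fintype V]
    (T : PlaneTriangulation V) (S : Set V) : Prop :=
  ∃ f : Fin C.1 → V, IsContainMap C.2 T f ∧ Set.range f ⊆ S

/-- The configuration `C` is induced in `T` within the set `S` of vertices. -/
def ConfigOn.InducedIn (C : ConfigOn) {V : Type} [Fintype V]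
    (T : PlaneTriangulation V) (S : Set V) : Prop :=
  ∃ f : Fin C.1 → V, IsContainMap C.2 T f ∧ Set.range f ⊆ S ∧
    ∀ a b : Fin C.1, T.graph.Adj (f a) (f b) → C.2.graph.Adj a b

/-- Paper condition (ii) of Lemma `induced-config`: any two vertices at
distance exactly 4 are joined by a length-4 path which either is not contained
in the outer face boundary, or contains an internal vertex which is not a
cut-vertex and has external degree at least 2. -/
def SecondNbrCond {A : Type} [Fintype A] (C : Configuration A) : Prop :=
  ∀ u w : A, C.graph.dist u w = 4 →
    ∃ p : C.graph.Walk u w, p.IsPath ∧ p.length = 4 ∧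
      ((¬ ∀ d ∈ p.darts, C.toNearTriangulation.IsOuterEdge d.toProd.1 d.toProd.2) ∨
        ∃ x ∈ p.support, x ≠ u ∧ x ≠ w ∧ ¬ IsCutVertex C.graph x ∧
          vdeg C.graph x + 2 ≤ C.δ x)

/-! ### Balls and obstructing cycles -/

/-- The set of vertices at distance at most `k` from `v` (vertex set of `B_k(v)`). -/
def ballSet {V : Type} (G : SimpleGraph V) (v : V) (k : ℕ) : Set V :=
  {u | ∃ p : G.Walk v u, p.length ≤ k}

/-- Vertex set of the degree-bounded ball `B^8_k(v)`. -/
def dBallSet {V : Type} (G : SimpleGraph V) (v : V) (k : ℕ) : Set V :=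
  {u | ∃ p : G.Walk v u, p.length ≤ k ∧ ∀ x ∈ p.support, x = v ∨ vdeg G x ≤ 8}

/-- Vertex set of the extended degree-bounded ball `B̄^8_k(v)`. -/
def extdBallSet {V : Type} (G : SimpleGraph V) (v : V) (k : ℕ) : Set V :=
  dBallSet G v k ∪
    {u | 9 ≤ vdeg G u ∧ ∃ p : G.Walk v u, p.length ≤ k ∧
      ∀ x ∈ p.support, x = v ∨ x = u ∨ vdeg G x ≤ 8}

/-- An obstructing cycle: a cycle of length at most 4 with at least one vertex
on each of its two sides, or of length 5 with at least two vertices on each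
side.  (The two sides of a cycle of a plane triangulation are unions of
components of the complement, with no edges from one side to the other.) -/
def IsObstructingCycle {V : Type} {G : SimpleGraph V} {x : V} (c : G.Walk x x) : Prop :=
  c.IsCycle ∧
  ∃ A B : Set V,
    (∀ v : V, v ∉ c.support → v ∈ A ∨ v ∈ B) ∧
    (∀ v ∈ A, v ∉ c.support) ∧ (∀ v ∈ B, v ∉ c.support) ∧
    Disjoint A B ∧
    (∀ a ∈ A, ∀ b ∈ B, ¬ G.Adj a b) ∧
    ((c.length ≤ 4 ∧ A.Nonempty ∧ B.Nonempty) ∨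
      (c.length = 5 ∧ 2 ≤ A.ncard ∧ 2 ≤ B.ncard))

/-- `G` has an obstructing cycle all of whose vertices lie in `S`. -/
def HasObstructingCycleIn {V : Type} (G : SimpleGraph V) (S : Set V) : Prop :=
  ∃ (x : V) (c : G.Walk x x), IsObstructingCycle c ∧ ∀ y ∈ c.support, y ∈ S

/-- A chordless cycle: every edge of `G` between vertices of the cycle is an
edge of the cycle. -/
def IsChordless {V : Type} {G : SimpleGraph V} {x : V} (c : G.Walk x x) : Prop :=
  ∀ u v : V, u ∈ c.support → v ∈ c.support → G.Adj u v → s(u, v) ∈ c.edges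

/-- Two vertex sets touch: they share a vertex, or an edge of `G` joins them. -/
def Touches {V : Type} (G : SimpleGraph V) (S S' : Set V) : Prop :=
  (S ∩ S').Nonempty ∨ ∃ s ∈ S, ∃ t ∈ S', G.Adj s t

/-- A `k`-local obstructing cycle around `v`, with designated public part
`pub`: the cycle lies in `B̄^8_k(v)`, the public part consists of at most two
vertices which are consecutive on the cycle, and everything outside the public
part (the private part) lies in `B^8_k(v)`. -/
def IsLocalObstructing {V : Type} (G : SimpleGraph V) (v : V) (k : ℕ) {x : V}
    (c : G.Walk x x) (pub : Set V) : Prop :=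
  IsObstructingCycle c ∧
  (∀ y ∈ c.support, y ∈ extdBallSet G v k) ∧
  pub ⊆ {y | y ∈ c.support} ∧
  pub.ncard ≤ 2 ∧
  (∀ y ∈ pub, ∀ z ∈ pub, y ≠ z → s(y, z) ∈ c.edges) ∧
  (∀ y ∈ c.support, y ∉ pub → y ∈ dBallSet G v k)

/-! ### Discharging and charges -/

/-- Initial charge `T₀(v) = 10·(6 − d(v))`. -/
noncomputable def initialCharge {V : Type} (G : SimpleGraph V) (v : V) : ℤ :=
  10 * (6 - (vdeg G v : ℤ))

/-- Final charge of `v`, given the function `send u v` recording the total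
charge sent from `u` to `v` by the discharging rules (`send u v = 0` for
non-adjacent `u, v`). -/
noncomputable def finalCharge {V : Type} [Fintype V] (G : SimpleGraph V)
    (send : V → V → ℤ) (v : V) : ℤ :=
  initialCharge G v + ∑ u : V, (send u v - send v u)

/-- A discharging assignment: for every plane triangulation, an amount of
charge sent along each ordered pair of vertices, nonnegative and vanishing on
non-adjacent pairs.  (The paper's fixed set `ℛ` of 43 discharging rules
determines such an assignment.) -/
def IsDischargeAssignment
    (Φ : ∀ (V : Type) [Fintype V], PlaneTriangulation V → V → V → ℤ) : Prop :=
  ∀ (V : Type) [Fintype V] (T : PlaneTriangulation V) (u v : V),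
    (¬ T.graph.Adj u v → Φ V T u v = 0) ∧ 0 ≤ Φ V T u v

/-! ### Colorings and Kempe changes -/

/-- A proper 4-coloring. -/
def IsProperColoring {U : Type} (G : SimpleGraph U) (c : U → Fin 4) : Prop :=
  ∀ ⦃u v : U⦄, G.Adj u v → c u ≠ c v

/-- `u` and `w` lie in a common `ab`-Kempe chain inside `S`. -/
def KempeConnOn {U : Type} (G : SimpleGraph U) (S : Set U) (c : U → Fin 4)
    (a b : Fin 4) (u w : U) : Prop :=
  ∃ p : G.Walk u w, ∀ x ∈ p.support, x ∈ S ∧ (c x = a ∨ c x = b)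

/-- A Kempe change (within the vertex set `S`): for complementary color pairs
`{a,b}` and `{e,f}`, swap the two colors on some `ab`-Kempe chains and some
`ef`-Kempe chains. -/
def IsKempeChangeOn {U : Type} (G : SimpleGraph U) (S : Set U)
    (c c' : U → Fin 4) : Prop :=
  (∀ v ∉ S, c' v = c v) ∧
  ∃ a b e f : Fin 4, ({a, b, e, f} : Set (Fin 4)) = Set.univ ∧
    (∀ v ∈ S, c' v = c v ∨ (c v = a ∧ c' v = b) ∨ (c v = b ∧ c' v = a) ∨
      (c v = e ∧ c' v = f) ∨ (c v = f ∧ c' v = e)) ∧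
    (∀ u w : U, (KempeConnOn G S c a b u w ∨ KempeConnOn G S c e f u w) →
      ((c' u = c u) ↔ (c' w = c w)))

/-- A Kempe change. -/
def IsKempeChange {U : Type} (G : SimpleGraph U) (c c' : U → Fin 4) : Prop :=
  IsKempeChangeOn G Set.univ c c'

/-- A single Kempe change: swap two colors on one Kempe chain. -/
def IsSingleKempeChange {U : Type} (G : SimpleGraph U) (c c' : U → Fin 4) : Prop :=
  ∃ a b : Fin 4, a ≠ b ∧ ∃ u₀ : U, (c u₀ = a ∨ c u₀ = b) ∧
    ∀ v : U,
      (KempeConnOn G Set.univ c a b u₀ v →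
        ((c v = a ∧ c' v = b) ∨ (c v = b ∧ c' v = a))) ∧
      (¬ KempeConnOn G Set.univ c a b u₀ v → c' v = c v)

/-- Two colorings agree up to a permutation of the colors. -/
def ColorPermEq {α : Type} (κ κ' : α → Fin 4) : Prop :=
  ∃ σ : Equiv.Perm (Fin 4), ∀ x : α, κ' x = σ (κ x)

/-! ### Free completions, rings, reducibility -/

/-- A free completion of the configuration `C`, with ring vertex set `W`:
a near-triangulation on `A ⊕ W` whose outer face is the ring cycle on `W`
(disjoint from `C`), containing `C` with the prescribed degrees and inner
faces. -/
structure FreeCompletion {A : Type} [Fintype A] (C : Configuration A)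
    (W : Type) [Fintype W] where
  nt : NearTriangulation (A ⊕ W)
  ring_outer : ∀ x : A ⊕ W, nt.OnOuter x ↔ ∃ w : W, x = Sum.inr w
  outer_simple : ∀ d d' : nt.graph.Dart, nt.isOuter d → nt.isOuter d' →
    d.toProd.1 = d'.toProd.1 → d = d'
  adj_iff : ∀ a b : A, nt.graph.Adj (Sum.inl a) (Sum.inl b) ↔ C.graph.Adj a b
  deg_eq : ∀ a : A, vdeg nt.graph (Sum.inl a) = C.δ a
  faces_comm : ∀ d : C.graph.Dart, ¬ C.isOuter d →
    nt.emb.facePerm (dartMap Sum.inl (fun a b hab => (adj_iff a b).mpr hab) d) =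
      dartMap Sum.inl (fun a b hab => (adj_iff a b).mpr hab) (C.emb.facePerm d)
  ring_edges_outer : ∀ w w' : W, nt.graph.Adj (Sum.inr w) (Sum.inr w') →
    ∃ d : nt.graph.Dart, nt.isOuter d ∧
      ((d.toProd.1 = Sum.inr w ∧ d.toProd.2 = Sum.inr w') ∨
       (d.toProd.1 = Sum.inr w' ∧ d.toProd.2 = Sum.inr w))

namespace FreeCompletion

variable {A W : Type} [Fintype A] [Fintype W] {C : Configuration A}

/-- Adjacency on the ring. -/
def RingAdj (FC : FreeCompletion C W) (w w' : W) : Prop :=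
  FC.nt.graph.Adj (Sum.inr w) (Sum.inr w')

/-- A proper 4-coloring of the ring. -/
def RingProper (FC : FreeCompletion C W) (κ : W → Fin 4) : Prop :=
  ∀ w w' : W, FC.RingAdj w w' → κ w ≠ κ w'

end FreeCompletion

/-- `j` embeds a cycle into `G'` so that its image bounds a face of the
embedding `E'`. -/
def IsFacialEmbedding {W U : Type} {G' : SimpleGraph U} (E' : CombEmbedding G')
    (j : W → U) : Prop :=
  ∃ F : Set G'.Dart, F.Nonempty ∧ (∀ d ∈ F, E'.facePerm d ∈ F) ∧
    (∀ d ∈ F, ∀ d' ∈ F, ∃ n : ℕ, (E'.facePerm ^ n) d = d') ∧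
    (∀ w : W, ∃ d ∈ F, d.toProd.1 = j w) ∧
    (∀ d ∈ F, (∃ w : W, d.toProd.1 = j w) ∧ (∃ w : W, d.toProd.2 = j w))

/-- `i`-extendibility of a ring coloring `κ` (Birkhoff–Kempe reducibility):
`κ` is `0`-extendible if it extends to a proper 4-coloring of the free
completion; it is `(i+1)`-extendible if it is `i`-extendible or if, for every
plane graph `G'` containing the ring as a facial cycle and every proper
4-coloring of `G'` extending `κ`, some Kempe change yields a coloring whose
restriction to the ring is `i`-extendible. -/
def FreeCompletion.Extendible {A W : Type} [Fintype A] [Fintype W]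
    {C : Configuration A} (FC : FreeCompletion C W) :
    ℕ → (W → Fin 4) → Prop
  | 0, κ => ∃ c : A ⊕ W → Fin 4, IsProperColoring FC.nt.graph c ∧
      ∀ w : W, c (Sum.inr w) = κ w
  | (i + 1), κ => FreeCompletion.Extendible FC i κ ∨
      ∀ (U : Type) [Fintype U] (G' : SimpleGraph U) (E' : CombEmbedding G'),
        E'.IsSpherical →
        ∀ j : W → U, Function.Injective j →
          (∀ w w' : W, FC.RingAdj w w' ↔ G'.Adj (j w) (j w')) →
          IsFacialEmbedding E' j →
          ∀ c : U → Fin 4, IsProperColoring G' c → (∀ w : W, c (j w) = κ w) →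
            ∃ c' : U → Fin 4, IsProperColoring G' c' ∧ IsKempeChange G' c c' ∧
              FreeCompletion.Extendible FC i (fun w => c' (j w))

/-- The reducibility level of a ring coloring: the least `i` such that it is
`i`-extendible. -/
noncomputable def FreeCompletion.level {A W : Type} [Fintype A] [Fintype W]
    {C : Configuration A} (FC : FreeCompletion C W) (κ : W → Fin 4) : ℕ :=
  sInf {i : ℕ | FC.Extendible i κ}

/-- A configuration is D-reducible if, for some finite `i`, every proper
4-coloring of the ring of any free completion is `i`-extendible. -/
def DReducible {A : Type} [Fintype A] (C : Configuration A) : Prop :=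
  ∃ i : ℕ, ∀ (W : Type) [Fintype W] (FC : FreeCompletion C W) (κ : W → Fin 4),
    FC.RingProper κ → FC.Extendible i κ

/-- The defining properties of the paper's fixed set `𝒟` of 8202 D-reducible
configurations: each has at most 19 vertices, diameter at most 4, at most one
vertex of (prescribed) degree exceeding 8, ring size at most 18, and every
4-coloring of its ring is 25-extendible. -/
def DSetGood (𝓓 : Set ConfigOn) : Prop :=
  𝓓.ncard = 8202 ∧
  ∀ C ∈ 𝓓,
    C.1 ≤ 19 ∧
    (∀ a b : Fin C.1, C.2.graph.dist a b ≤ 4) ∧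
    ({v : Fin C.1 | 8 < C.2.δ v}).ncard ≤ 1 ∧
    ∃ (r : ℕ) (FC : FreeCompletion C.2 (Fin r)), r ≤ 18 ∧
      ∀ κ : Fin r → Fin 4, FC.RingProper κ → FC.Extendible 25 κ

end FourColor

namespace FourColor
open SimpleGraph

section Homology

variable {V : Type} {G : SimpleGraph V} [Fintype G.Dart] {X : Type} [Fintype X]

open Classical in
/-- The edge-by-label incidence matrix over `ZMod 2` of a labelling `g` of the darts. -/
noncomputable def dartMatrix (g : G.Dart → X) : Matrix G.edgeSet X (ZMod 2) :=
  fun e x => ∑ d : G.Dart, if d.edge = e ∧ g d = x then 1 else 0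

open Classical in
theorem dartMatrix_mulVec (g : G.Dart → X) (f : X → ZMod 2) (e : G.edgeSet) :
    (dartMatrix g).mulVec f e = ∑ d : G.Dart, if d.edge = e then f (g d) else 0 := by
  simp only [Matrix.mulVec, dotProduct, dartMatrix, Finset.sum_mul]
  rw [Finset.sum_comm]
  refine Finset.sum_congr rfl fun d _ => ?_
  by_cases h : d.edge = e <;> simp [h]

theorem dartMatrix_mulVec_edge (g : G.Dart → X) (f : X → ZMod 2) (d : G.Dart) :
    (dartMatrix g).mulVec f ⟨d.edge, d.edge_mem⟩ = f (g d) + f (g d.symm) := by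
  classical
  rw [dartMatrix_mulVec, ← Finset.sum_filter]
  have : (Finset.univ.filter fun d' : G.Dart => d'.edge = d.edge) = {d, d.symm} := by
    ext d'
    simp [dart_edge_eq_iff]
  rw [this, Finset.sum_pair d.symm_ne.symm]

theorem dotProduct_dartMatrix_mulVec [Fintype G.edgeSet] (g : G.Dart → X) (f : X → ZMod 2)
    (z : G.edgeSet → ZMod 2) :
    z ⬝ᵥ (dartMatrix g).mulVec f = ∑ d : G.Dart, z ⟨d.edge, d.edge_mem⟩ * f (g d) := by
  classical
  simp only [dotProduct, dartMatrix_mulVec, Finset.mul_sum]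
  rw [Finset.sum_comm]
  refine Finset.sum_congr rfl fun d _ => ?_
  rw [Finset.sum_eq_single ⟨d.edge, d.edge_mem⟩]
  · simp
  · intro e _ he
    rw [if_neg fun h => he (Subtype.ext h.symm), mul_zero]
  · simp

theorem dartMatrix_rank_add_one [Nonempty X] (g : G.Dart → X)
    (hg : ∀ f : X → ZMod 2, (∀ d, f (g d) = f (g d.symm)) → ∀ x y, f x = f y) :
    (dartMatrix g).rank + 1 = Fintype.card X := by
  have hker : Module.finrank (ZMod 2) (dartMatrix g).mulVecLin.ker = 1 := by
    obtain ⟨x₀⟩ := ‹Nonempty X›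
    have hone : (fun _ => 1) ∈ (dartMatrix g).mulVecLin.ker := by
      rw [LinearMap.mem_ker, Matrix.mulVecLin_apply]
      ext ⟨e, he⟩
      induction e with | _ u v => ?_
      exact (dartMatrix_mulVec_edge g _ ⟨(u, v), he⟩).trans (CharTwo.add_self_eq_zero _)
    refine finrank_eq_one_iff_of_nonzero' ⟨_, hone⟩ ?_ |>.2 ?_
    · intro h
      exact one_ne_zero (congrFun (congrArg Subtype.val h) x₀)
    · rintro ⟨f, hf⟩
      refine ⟨f x₀, Subtype.ext (funext fun x => ?_)⟩
      have := hg f (fun d => ?_) x₀ x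
      · simpa using this
      · rw [LinearMap.mem_ker, Matrix.mulVecLin_apply] at hf
        have h := dartMatrix_mulVec_edge g f d
        rw [hf] at h
        exact CharTwo.add_eq_zero.1 h.symm
  have := (dartMatrix g).mulVecLin.finrank_range_add_finrank_ker
  rw [hker, Module.finrank_fintype_fun_eq_card] at this
  exact this

end Homology

namespace CombEmbedding

variable {V : Type} {G : SimpleGraph V} (E : CombEmbedding G)

theorem facePerm_apply (d : G.Dart) : E.facePerm d = E.rot d.symm := rfl

theorem facePerm_symm (d : G.Dart) : E.facePerm d.symm = E.rot d := by
  rw [facePerm_apply, Dart.symm_symm]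

theorem facePerm_fst (d : G.Dart) : (E.facePerm d).fst = d.snd := E.rot_fst d.symm

/-- The face to the side of a dart. -/
def face (d : G.Dart) : Quotient E.faceSetoid := Quotient.mk _ d

theorem face_facePerm (d : G.Dart) : E.face (E.facePerm d) = E.face d :=
  Quotient.sound (E.faceSetoid.symm ⟨1, by simp⟩)

theorem face_rot (d : G.Dart) : E.face (E.rot d) = E.face d.symm := by
  rw [← facePerm_symm, face_facePerm]

/-- On a connected plane graph every mod-2 cycle is a sum of face boundaries: it is the
coboundary of a 2-colouring of the faces. -/
theorem exists_face_potential [Fintype V] [Fintype G.Dart] [Fintype G.edgeSet]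
    (hconn : G.Connected) (hd : Nonempty G.Dart)
    (heuler : (Fintype.card V : ℤ) - (G.edgeSet.ncard : ℤ) + (E.numFaces : ℤ) = 2)
    (z : G.edgeSet → ZMod 2)
    (hz : ∀ f : V → ZMod 2,
      z ⬝ᵥ (dartMatrix (fun d : G.Dart => d.fst)).mulVec f = 0) :
    ∃ S : Quotient E.faceSetoid → ZMod 2,
      ∀ d : G.Dart, S (E.face d) + S (E.face d.symm) = z ⟨d.edge, d.edge_mem⟩ := by
  classical
  have : Fintype (Quotient E.faceSetoid) := Fintype.ofFinite _
  have : Nonempty V := hconn.nonempty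
  have : Nonempty (Quotient E.faceSetoid) := hd.map E.face
  set M := dartMatrix (fun d : G.Dart => d.fst)
  set N := dartMatrix E.face
  have hM : M.rank + 1 = Fintype.card V := by
    refine dartMatrix_rank_add_one _ fun f hf x y => ?_
    obtain ⟨p⟩ := hconn.preconnected x y
    induction p with
    | nil => rfl
    | cons h _ ih => exact (hf ⟨(_, _), h⟩).trans ih
  have hN : N.rank + 1 = Fintype.card (Quotient E.faceSetoid) := by
    refine dartMatrix_rank_add_one _ fun f hf => ?_
    have hrot : ∀ d d' : G.Dart, d.fst = d'.fst → f (E.face d) = f (E.face d') := by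
      intro d d' h
      obtain ⟨n, rfl⟩ := E.rot_cyclic d d' h
      clear h
      induction n with
      | zero => rfl
      | succ n ih => rw [ih, pow_succ', Equiv.Perm.mul_apply, face_rot, hf]
    have hwalk : ∀ (u v : V), G.Walk u v → ∀ d d' : G.Dart, d.fst = u → d'.fst = v →
        f (E.face d) = f (E.face d') := by
      intro u v p
      induction p with
      | nil => exact fun d d' h h' => hrot d d' (h.trans h'.symm)
      | cons h _ ih =>
        intro d d' hd hd'
        rw [hrot d ⟨(_, _), h⟩ hd, hf]
        exact ih _ _ rfl hd'
    intro x y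
    induction x using Quotient.inductionOn with | _ d => ?_
    induction y using Quotient.inductionOn with | _ d' => ?_
    obtain ⟨p⟩ := hconn.preconnected d.fst d'.fst
    exact hwalk _ _ p d d' rfl rfl
  have horth : ∀ S f, N.mulVec S ⬝ᵥ M.mulVec f = 0 := by
    intro S f
    rw [dotProduct_comm, dotProduct_dartMatrix_mulVec]
    simp only [M, dartMatrix_mulVec_edge, add_mul, Finset.sum_add_distrib]
    rw [← Equiv.sum_comp E.facePerm, ← Finset.sum_add_distrib]
    refine Finset.sum_eq_zero fun d _ => ?_
    rw [face_facePerm, facePerm_fst]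
    exact CharTwo.add_self_eq_zero _
  have hmem : ∀ y : G.edgeSet → ZMod 2, (∀ f, y ⬝ᵥ M.mulVec f = 0) →
      y ∈ M.transpose.mulVecLin.ker := by
    intro y hy
    rw [LinearMap.mem_ker, Matrix.mulVecLin_apply]
    refine dotProduct_eq_zero _ fun f => ?_
    rw [Matrix.mulVec_transpose, ← Matrix.dotProduct_mulVec, hy]
  have hle : N.mulVecLin.range ≤ M.transpose.mulVecLin.ker := by
    rintro _ ⟨S, rfl⟩
    exact hmem _ (horth S)
  have heq : N.mulVecLin.range = M.transpose.mulVecLin.ker := by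
    refine Submodule.eq_of_le_of_finrank_eq hle ?_
    have h1 := M.transpose.mulVecLin.finrank_range_add_finrank_ker
    have h2 : Module.finrank (ZMod 2) M.transpose.mulVecLin.range = M.rank :=
      Matrix.rank_transpose M
    rw [h2, Module.finrank_fintype_fun_eq_card] at h1
    have h3 : Module.finrank (ZMod 2) N.mulVecLin.range = N.rank := rfl
    rw [h3]
    rw [numFaces, Nat.card_eq_fintype_card, Set.ncard_eq_toFinset_card',
      Set.toFinset_card] at heuler
    omega
  obtain ⟨S, hS⟩ := heq.ge (hmem z hz)
  refine ⟨S, fun d => ?_⟩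
  rw [← hS]
  exact (dartMatrix_mulVec_edge E.face S d).symm

end CombEmbedding

theorem count_edges_dotProduct_dartMatrix_mulVec {V : Type} [DecidableEq V] [Fintype V]
    {G : SimpleGraph V} [Fintype G.Dart] [Fintype G.edgeSet] (f : V → ZMod 2) {u v : V}
    (p : G.Walk u v) :
    (fun e : G.edgeSet => ((p.edges.count e.1 : ℕ) : ZMod 2)) ⬝ᵥ
      (dartMatrix (fun d : G.Dart => d.fst)).mulVec f = f u + f v := by
  induction p with
  | nil => simp [CharTwo.add_self_eq_zero, dotProduct]
  | @cons u v w h p ih =>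
    have hsplit : (fun e : G.edgeSet => (((Walk.cons h p).edges.count e.1 : ℕ) : ZMod 2)) =
        (fun e : G.edgeSet => ((p.edges.count e.1 : ℕ) : ZMod 2)) +
          Pi.single ⟨s(u, v), h⟩ 1 := by
      ext e
      by_cases he : e = ⟨s(u, v), h⟩
      · subst he; simp
      · have he' : s(u, v) ≠ e.1 := fun h' => he (Subtype.ext h'.symm)
        simp [he, he']
    rw [hsplit, add_dotProduct, ih, single_dotProduct, one_mul]
    rw [show (⟨s(u, v), h⟩ : G.edgeSet) = ⟨Dart.edge ⟨(u, v), h⟩, h⟩ from rfl,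
      dartMatrix_mulVec_edge]
    change f v + f w + (f u + f v) = f u + f w
    linear_combination CharTwo.add_self_eq_zero (f v)

namespace CombEmbedding

variable {V : Type} {G : SimpleGraph V} (E : CombEmbedding G)

/-- Two walks of a connected plane graph whose ends alternate along a simple outer face meet. -/
theorem exists_mem_support_of_crossing [Fintype V]
    (hconn : G.Connected)
    (heuler : (Fintype.card V : ℤ) - (G.edgeSet.ncard : ℤ) + (E.numFaces : ℤ) = 2)
    {isOuter : G.Dart → Prop}
    (hiff : ∀ d, isOuter (E.facePerm d) ↔ isOuter d)
    (hsimple : ∀ d d', isOuter d → isOuter d' → d.fst = d'.fst → d = d')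
    (hsymm : ∀ d, isOuter d → ¬ isOuter d.symm)
    (hface : ∀ d d', isOuter d → isOuter d' → E.face d = E.face d')
    {d : G.Dart} (hd : isOuter d) (h2 : E.facePerm (E.facePerm d) ≠ d)
    (h3 : E.facePerm (E.facePerm (E.facePerm d)) ≠ d)
    (p : G.Walk d.fst (E.facePerm (E.facePerm d)).fst)
    (q : G.Walk (E.facePerm d).fst (E.facePerm (E.facePerm (E.facePerm d))).fst) :
    ∃ x ∈ p.support, x ∈ q.support := by
  classical
  by_contra! hdisj
  have ha₁ : G.Adj (E.facePerm (E.facePerm d)).fst (E.facePerm d).fst := by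
    rw [E.facePerm_fst (E.facePerm d)]; exact (E.facePerm d).adj.symm
  have ha₂ : G.Adj (E.facePerm d).fst d.fst := by
    rw [E.facePerm_fst d]; exact d.adj.symm
  set c : G.Walk d.fst d.fst := p.append (Walk.cons ha₁ (Walk.cons ha₂ Walk.nil)) with hc
  obtain ⟨S, hS⟩ := E.exists_face_potential hconn ⟨d⟩ heuler
    (fun e => ((c.edges.count e.1 : ℕ) : ZMod 2)) fun f => by
      rw [count_edges_dotProduct_dartMatrix_mulVec, CharTwo.add_self_eq_zero]
  set s : G.Dart → ZMod 2 := fun e => S (E.face e) with hs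
  have hsrot : ∀ e, s (E.rot e) = s e.symm := fun e => congrArg S (E.face_rot e)
  have hrot : ∀ e, isOuter (E.rot e) ↔ isOuter e.symm := fun e => by
    rw [← facePerm_symm, hiff]
  have hd₁ : isOuter (E.facePerm d) := (hiff _).2 hd
  have hedge : ∀ e e', isOuter e → isOuter e' → e.edge = e'.edge → e = e' := by
    intro e e' he he' h
    rcases (dart_edge_eq_iff _ _).1 h with h | rfl
    · exact h
    · exact absurd he (hsymm _ he')
  have hz : ∀ e : G.Dart, e.fst ∉ p.support → s e + s e.symm =
      (if (E.facePerm d).edge = e.edge then 1 else 0) + if d.edge = e.edge then 1 else 0 := by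
    intro e he
    have hp : p.edges.count e.edge = 0 :=
      List.count_eq_zero.2 fun h => he (p.fst_mem_support_of_mem_edges h)
    have e₁ : s((E.facePerm (E.facePerm d)).fst, (E.facePerm d).fst) = (E.facePerm d).edge := by
      rw [E.facePerm_fst (E.facePerm d)]; exact Sym2.eq_swap
    have e₂ : s((E.facePerm d).fst, d.fst) = d.edge := by
      rw [E.facePerm_fst d]; exact Sym2.eq_swap
    have := hS e
    simp only [hc, Walk.edges_append, Walk.edges_cons, Walk.edges_nil, List.count_append, hp,
      List.count_cons, List.count_nil, e₁, e₂] at this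
    refine this.trans ?_
    push_cast
    simp [add_comm]
  have hz₀ : ∀ e : G.Dart, e.fst ∉ p.support → ¬ isOuter e → ¬ isOuter e.symm →
      s e = s e.symm := by
    intro e he ho ho'
    have hne : ∀ e', isOuter e' → e'.edge ≠ e.edge := by
      intro e' he' h
      rcases (dart_edge_eq_iff _ _).1 h with rfl | rfl
      exacts [ho he', ho' he']
    have := hz e he
    rw [if_neg (hne _ hd₁), if_neg (hne _ hd), add_zero] at this
    exact CharTwo.add_eq_zero.1 this
  have hbase : ∀ e₀ : G.Dart, e₀.fst ∉ p.support →
      (∀ e, e.fst = e₀.fst → isOuter e → e = e₀) →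
      ∀ e, e.fst = e₀.fst → ¬ isOuter e → s e = s (E.rot e₀) := by
    intro e₀ he₀ huniq e he
    obtain ⟨n, rfl⟩ := E.rot_cyclic e₀ e he.symm
    clear he
    have hfst : ∀ n : ℕ, ((E.rot ^ n) e₀).fst = e₀.fst := by
      intro n
      induction n with
      | zero => rfl
      | succ n ih => rw [pow_succ', Equiv.Perm.mul_apply]; exact (E.rot_fst _).trans ih
    induction n with
    | zero =>
      intro ho
      rw [hsrot]
      refine hz₀ _ he₀ ho fun ho' => ho ?_
      have := (hrot e₀).2 ho'
      rwa [← huniq _ (E.rot_fst _) this]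
    | succ n ih =>
      rw [pow_succ', Equiv.Perm.mul_apply]
      intro ho
      by_cases h : isOuter ((E.rot ^ n) e₀)
      · rw [huniq _ (hfst n) h]
      · rw [← ih h, hsrot]
        exact (hz₀ _ (by rwa [hfst]) h fun h' => ho ((hrot _).2 h')).symm
  have hconst : ∀ e e' : G.Dart, e.fst ∉ p.support → e.fst = e'.fst → ¬ isOuter e →
      ¬ isOuter e' → s e = s e' := by
    intro e e' he hee ho ho'
    by_cases h : ∃ e₀, e₀.fst = e.fst ∧ isOuter e₀
    · obtain ⟨e₀, h₀, ho₀⟩ := h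
      have := hbase e₀ (by rwa [h₀]) fun e h h' => hsimple _ _ h' ho₀ h
      rw [this e h₀.symm ho, this e' (hee.symm.trans h₀.symm) ho']
    · have := hbase e he fun e₀ h₀ ho₀ => absurd ⟨e₀, h₀, ho₀⟩ h
      rw [this e rfl ho, this e' hee.symm ho']
  have hex : ∀ e : G.Dart, ∃ e', e'.fst = e.fst ∧ ¬ isOuter e' := by
    intro e
    by_cases h : isOuter e
    · exact ⟨E.rot e, E.rot_fst e, fun h' => hsymm e h ((hrot e).1 h')⟩
    · exact ⟨e, rfl, h⟩
  have hwalk : ∀ {x y : V} (q : G.Walk x y), (∀ w ∈ q.support, w ∉ p.support) →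
      ∀ e e', e.fst = x → e'.fst = y → ¬ isOuter e → ¬ isOuter e' → s e = s e' := by
    intro x y q
    induction q with
    | nil =>
      intro hq e e' he he'
      exact hconst e e' (by rw [he]; exact hq _ (by simp)) (he.trans he'.symm)
    | @cons x w y h q ih =>
      intro hq e e' he he' ho ho'
      have hx : x ∉ p.support := hq _ (by simp)
      have hw : w ∉ p.support := hq _ (by simp)
      obtain ⟨e₁, he₁, ho₁⟩ := hex ⟨(w, x), h.symm⟩
      refine Eq.trans ?_ (ih (fun w hw => hq w (by simp [hw])) e₁ e' he₁ he' ho₁ ho')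
      set a : G.Dart := ⟨(x, w), h⟩ with ha
      by_cases h₁ : isOuter a
      · have h₂ := hsymm _ h₁
        rw [hconst e (E.rot a) (by rwa [he]) (he.trans (E.rot_fst a).symm) ho
          (fun h' => h₂ ((hrot a).1 h')), hsrot]
        exact hconst a.symm e₁ hw he₁.symm h₂ ho₁
      by_cases h₂ : isOuter a.symm
      · rw [hconst e₁ (E.rot a.symm) (by rwa [he₁]) (he₁.trans (E.rot_fst a.symm).symm) ho₁
          (fun h' => h₁ ((hrot a.symm).1 h')), hsrot]
        exact hconst e a (by rwa [he]) he ho h₁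
      · rw [hconst e a (by rwa [he]) he ho h₁, hz₀ a hx h₁ h₂]
        exact hconst a.symm e₁ hw he₁.symm h₂ ho₁
  have hd₃ : isOuter (E.facePerm (E.facePerm (E.facePerm d))) :=
    (hiff _).2 ((hiff _).2 hd₁)
  have hnot : ∀ e, isOuter e → ¬ isOuter (E.rot e) := fun e he h' => hsymm e he ((hrot e).1 h')
  have hkey := hwalk q (fun w hw h' => hdisj w h' hw) _ _ (E.rot_fst (E.facePerm d))
    (E.rot_fst (E.facePerm (E.facePerm (E.facePerm d)))) (hnot _ hd₁) (hnot _ hd₃)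
  rw [hsrot, hsrot] at hkey
  have hz₁ := hz (E.facePerm d) fun h => hdisj _ h q.start_mem_support
  have hz₃ := hz (E.facePerm (E.facePerm (E.facePerm d))) fun h => hdisj _ h q.end_mem_support
  rw [if_pos rfl, if_neg fun h => h2 (by rw [← hedge _ _ hd hd₁ h, ← hedge _ _ hd hd₁ h])] at hz₁
  rw [if_neg fun h => h2 (E.facePerm.injective (hedge _ _ hd₁ hd₃ h).symm),
    if_neg fun h => h3 (hedge _ _ hd hd₃ h).symm, ← hkey] at hz₃
  have hs₁₃ : s (E.facePerm d) = s (E.facePerm (E.facePerm (E.facePerm d))) :=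
    congrArg S (hface _ _ hd₁ hd₃)
  rw [← hs₁₃, hz₁] at hz₃
  exact absurd hz₃ (by decide)

end CombEmbedding

/-- Walks of `G` joining alternating pairs of vertices of the 5-cycle `w` always meet. -/
def RingNoncrossing {V : Type} (G : SimpleGraph V) (w : Fin 5 → V) : Prop :=
  ∀ (i : Fin 5) (p : G.Walk (w (i + 1)) (w (i + 3))) (q : G.Walk (w (i + 2)) (w (i + 4))),
    ∃ x ∈ p.support, x ∈ q.support

theorem NearTriangulation.isOuter_facePerm_iff {V : Type} [Fintype V] (N : NearTriangulation V)
    (d : N.graph.Dart) : N.isOuter (N.emb.facePerm d) ↔ N.isOuter d := by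
  classical
  refine ⟨fun h => ?_, N.outer_closed d⟩
  have hpow : ∀ (n : ℕ) d', N.isOuter d' → N.isOuter ((N.emb.facePerm ^ n) d') := by
    intro n d' hd'
    induction n with
    | zero => exact hd'
    | succ n ih => rw [pow_succ', Equiv.Perm.mul_apply]; exact N.outer_closed _ ih
  obtain ⟨n, hn⟩ : ∃ n : ℕ, (N.emb.facePerm ^ n) (N.emb.facePerm d) = d := by
    have : 0 < orderOf N.emb.facePerm := orderOf_pos _
    refine ⟨orderOf N.emb.facePerm - 1, ?_⟩
    rw [← Equiv.Perm.mul_apply, ← pow_succ, Nat.sub_add_cancel this, pow_orderOf_eq_one]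
    rfl
  rw [← hn]
  exact hpow n _ h

/-- A simple outer face with five vertices has a noncrossing cyclic enumeration. -/
theorem NearTriangulation.exists_ringNoncrossing {V : Type} [Fintype V]
    (N : NearTriangulation V) (rv : Fin 5 → V) (hinj : Function.Injective rv)
    (hadj : ∀ i : Fin 5, N.graph.Adj (rv i) (rv (i + 1)))
    (hout : ∀ x : V, N.OnOuter x ↔ ∃ i : Fin 5, rv i = x)
    (hsimple : ∀ d d' : N.graph.Dart, N.isOuter d → N.isOuter d' →
      d.toProd.1 = d'.toProd.1 → d = d') :
    ∃ w : Fin 5 → V, Function.Injective w ∧ (∀ i, ∃ j, rv i = w j) ∧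
      RingNoncrossing N.graph w := by
  classical
  set φ := N.emb.facePerm with hφ
  have hdart : ¬ IsEmpty N.graph.Dart := fun h => h.false ⟨(_, _), hadj 0⟩
  have hout' : ∀ i, ∃ d, N.isOuter d ∧ d.fst = rv i := fun i =>
    ((hout (rv i)).2 ⟨i, rfl⟩).resolve_left hdart
  set O : Finset N.graph.Dart := Finset.univ.filter N.isOuter with hO
  have hcard : O.card = 5 := by
    have h₁ : O.image (fun d => d.fst) = Finset.univ.image rv := by
      ext x
      simp only [Finset.mem_image, Finset.mem_univ, true_and, hO, Finset.mem_filter]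
      rw [← hout x]
      exact ⟨fun h => Or.inr h, fun h => h.resolve_left hdart⟩
    rw [← Finset.card_image_of_injOn (f := fun d : N.graph.Dart => d.fst), h₁,
      Finset.card_image_of_injective _ hinj, Finset.card_univ, Fintype.card_fin]
    intro d hd d' hd' h
    simp only [hO, Finset.coe_filter, Finset.mem_univ, true_and, Set.mem_ofPred_eq] at hd hd'
    exact hsimple d d' hd hd' h
  have hcyc : φ.IsCycleOn (O : Set N.graph.Dart) := by
    refine ⟨⟨fun d hd => ?_, φ.injective.injOn, fun d hd => ⟨φ.symm d, ?_, by simp⟩⟩,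
      fun d hd d' hd' => ?_⟩
    · simp only [hO, Finset.coe_filter, Finset.mem_univ, true_and, Set.mem_ofPred_eq] at hd ⊢
      exact N.outer_closed d hd
    · simp only [hO, Finset.coe_filter, Finset.mem_univ, true_and, Set.mem_ofPred_eq] at hd ⊢
      rw [← N.isOuter_facePerm_iff, ← hφ, Equiv.apply_symm_apply]
      exact hd
    · simp only [hO, Finset.coe_filter, Finset.mem_univ, true_and, Set.mem_ofPred_eq] at hd hd'
      obtain ⟨n, hn⟩ := N.outer_single d d' hd hd'
      exact ⟨n, by simpa using hn⟩
  obtain ⟨d₀, hd₀, -⟩ := hout' 0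
  have hd₀' : d₀ ∈ O := by simp [hO, hd₀]
  have hpow : ∀ {m n : ℕ}, (φ ^ m) d₀ = (φ ^ n) d₀ ↔ m ≡ n [MOD 5] := by
    intro m n
    rw [hcyc.pow_apply_eq_pow_apply hd₀', hcard]
  have hmem : ∀ n : ℕ, N.isOuter ((φ ^ n) d₀) := by
    intro n
    induction n with
    | zero => exact hd₀
    | succ n ih => rw [pow_succ', Equiv.Perm.mul_apply]; exact N.outer_closed _ ih
  have hall : ∀ d, N.isOuter d → ∃ n < 5, (φ ^ n) d₀ = d := by
    intro d hd
    rw [← hcard]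
    exact hcyc.exists_pow_eq hd₀' (by simp [hO, hd])
  have hne : ∀ k, ¬ 5 ∣ k → ∀ d, N.isOuter d → (φ ^ k) d ≠ d := by
    intro k hk d hd
    rw [Ne, hcyc.pow_apply_eq (by simp [hO, hd]), hcard]
    exact hk
  have hsymm : ∀ d, N.isOuter d → ¬ N.isOuter d.symm := by
    intro d hd hd'
    have h₁ : φ d = d.symm := hsimple _ _ (N.outer_closed d hd) hd' (N.emb.facePerm_fst d)
    have h₂ : φ d.symm = d := hsimple _ _ (N.outer_closed _ hd') hd (N.emb.facePerm_fst d.symm)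
    refine hne 2 (by decide) d hd ?_
    rw [pow_succ', pow_one, Equiv.Perm.mul_apply, h₁, h₂]
  have hface : ∀ d d', N.isOuter d → N.isOuter d' → N.emb.face d = N.emb.face d' := by
    intro d d' hd hd'
    obtain ⟨n, hn⟩ := N.outer_single d d' hd hd'
    exact Quotient.sound ⟨n, by simpa using hn⟩
  have heuler := N.euler.resolve_left fun h => by
    have := Fintype.card_le_of_injective rv hinj
    rw [Fintype.card_fin, h] at this
    omega
  have hw : ∀ (i k : Fin 5), (φ ^ ((i + k : Fin 5) : ℕ)) d₀ = (φ ^ (i.1 + k.1)) d₀ := by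
    intro i k
    rw [hpow, Fin.val_add]
    exact Nat.mod_modEq _ _
  refine ⟨fun i => ((φ ^ i.1) d₀).fst, fun i j h => ?_, fun i => ?_, fun i p q => ?_⟩
  · have := hpow.1 (hsimple _ _ (hmem _) (hmem _) h)
    exact Fin.ext (Nat.ModEq.eq_of_lt_of_lt this i.2 j.2)
  · obtain ⟨d, hd, hdi⟩ := hout' i
    obtain ⟨n, hn, rfl⟩ := hall d hd
    exact ⟨⟨n, hn⟩, hdi.symm⟩
  · set d := (φ ^ (i.1 + 1)) d₀ with hd
    have e₁ : (φ ^ ((i + 1 : Fin 5) : ℕ)) d₀ = d := hw i 1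
    have e₂ : (φ ^ ((i + 2 : Fin 5) : ℕ)) d₀ = φ d := by
      rw [hw i 2, hd, ← Equiv.Perm.mul_apply, ← pow_succ']; rfl
    have e₃ : (φ ^ ((i + 3 : Fin 5) : ℕ)) d₀ = φ (φ d) := by
      rw [hw i 3, hd, ← Equiv.Perm.mul_apply, ← Equiv.Perm.mul_apply, mul_assoc, ← pow_succ',
        ← pow_succ']; rfl
    have e₄ : (φ ^ ((i + 4 : Fin 5) : ℕ)) d₀ = φ (φ (φ d)) := by
      rw [hw i 4, hd, ← Equiv.Perm.mul_apply, ← Equiv.Perm.mul_apply, ← Equiv.Perm.mul_apply,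
        mul_assoc, mul_assoc, ← pow_succ', ← pow_succ', ← pow_succ']; rfl
    have := N.emb.exists_mem_support_of_crossing N.conn heuler N.isOuter_facePerm_iff hsimple
      hsymm hface (hmem (i.1 + 1)) (hne 2 (by decide) _ (hmem _)) (hne 3 (by decide) _ (hmem _))
      (p.copy (congrArg (·.fst) e₁) (congrArg (·.fst) e₃))
      (q.copy (congrArg (·.fst) e₂) (congrArg (·.fst) e₄))
    simpa using this

set_option synthInstance.maxSize 10000 in
/-- A Hamiltonian cycle of a pentagon none of whose edges cross is the pentagon itself. -/
theorem pentagon_eq_of_noncrossing :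
    ∀ a b c d e : Fin 5, [a, b, c, d, e].Nodup →
      (b = a + 1 ∧ c = a + 2 ∧ d = a + 3 ∧ e = a + 4) ∨
      (b = a - 1 ∧ c = a - 2 ∧ d = a - 3 ∧ e = a - 4) ∨
      ∃ p : Fin 5,
        ((p + 1, p + 3) ∈ [(a, b), (b, c), (c, d), (d, e), (e, a)] ∨
          (p + 3, p + 1) ∈ [(a, b), (b, c), (c, d), (d, e), (e, a)]) ∧
        ((p + 2, p + 4) ∈ [(a, b), (b, c), (c, d), (d, e), (e, a)] ∨
          (p + 4, p + 2) ∈ [(a, b), (b, c), (c, d), (d, e), (e, a)]) := by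
  decide +kernel

theorem NearTriangulation.ringNoncrossing {V : Type} [Fintype V]
    (N : NearTriangulation V) (rv : Fin 5 → V) (hinj : Function.Injective rv)
    (hadj : ∀ i : Fin 5, N.graph.Adj (rv i) (rv (i + 1)))
    (hout : ∀ x : V, N.OnOuter x ↔ ∃ i : Fin 5, rv i = x)
    (hsimple : ∀ d d' : N.graph.Dart, N.isOuter d → N.isOuter d' →
      d.toProd.1 = d'.toProd.1 → d = d') :
    RingNoncrossing N.graph rv := by
  obtain ⟨w, hw, hσ, hnc⟩ := N.exists_ringNoncrossing rv hinj hadj hout hsimple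
  choose σ hσ using hσ
  have hσi : Function.Injective σ := fun i j h => hinj (by rw [hσ, hσ, h])
  have hadj' : ∀ x ∈ [(σ 0, σ 1), (σ 1, σ 2), (σ 2, σ 3), (σ 3, σ 4), (σ 4, σ 0)],
      N.graph.Adj (w x.1) (w x.2) := by
    have := fun i => hσ (i + 1) ▸ hσ i ▸ hadj i
    simpa using ⟨this 0, this 1, this 2, this 3, this 4⟩
  have hcross : ∀ p : Fin 5, N.graph.Adj (w (p + 1)) (w (p + 3)) →
      N.graph.Adj (w (p + 2)) (w (p + 4)) → False := by
    intro p h₁ h₂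
    obtain ⟨x, hx, hx'⟩ := hnc p h₁.toWalk h₂.toWalk
    simp only [Walk.support_cons, Walk.support_nil, List.mem_cons, List.not_mem_nil,
      or_false] at hx hx'
    rcases hx with rfl | rfl <;> rcases hx' with h | h <;> replace h := hw h <;> revert h <;>
      clear * - <;> revert p <;> decide
  have hnodup : [σ 0, σ 1, σ 2, σ 3, σ 4].Nodup := (List.nodup_finRange 5).map hσi
  rcases pentagon_eq_of_noncrossing _ _ _ _ _ hnodup with h₁ | h₂ | ⟨p, hx, hy⟩
  · have hi : ∀ i, σ i = σ 0 + i := by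
      obtain ⟨h₁, h₂, h₃, h₄⟩ := h₁
      intro i
      fin_cases i
      exacts [(add_zero _).symm, h₁, h₂, h₃, h₄]
    intro i p q
    have hv : ∀ k, rv (i + k) = w (σ 0 + i + k) := fun k => by rw [hσ, hi, add_assoc]
    simpa using hnc (σ 0 + i) (p.copy (hv 1) (hv 3)) (q.copy (hv 2) (hv 4))
  · have hi : ∀ i, σ i = σ 0 - i := by
      obtain ⟨h₁, h₂, h₃, h₄⟩ := h₂
      intro i
      fin_cases i
      exacts [(sub_zero _).symm, h₁, h₂, h₃, h₄]
    intro i p q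
    have hv : ∀ k l : Fin 5, -k = l → rv (i + k) = w (σ 0 - i + l) := fun k l h => by
      rw [hσ, hi, ← h]; congr 1; abel
    have := hnc (σ 0 - i) (q.reverse.copy (hv 4 1 rfl) (hv 2 3 rfl))
      (p.reverse.copy (hv 3 2 rfl) (hv 1 4 rfl))
    simp only [Walk.support_copy, Walk.support_reverse, List.mem_reverse] at this
    obtain ⟨x, hx, hx'⟩ := this
    exact ⟨x, hx', hx⟩
  · exact (hcross p (hx.elim (hadj' _) fun h => (hadj' _ h).symm)
      (hy.elim (hadj' _) fun h => (hadj' _ h).symm)).elim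

section KempeSwap

variable {V : Type} {G : SimpleGraph V}

theorem KempeConnOn.color_right {S : Set V} {c : V → Fin 4} {a b : Fin 4} {u v : V}
    (h : KempeConnOn G S c a b u v) : c v = a ∨ c v = b := by
  obtain ⟨p, hp⟩ := h
  exact (hp v p.end_mem_support).2

theorem KempeConnOn.refl_univ {c : V → Fin 4} {a b : Fin 4} {u : V} (h : c u = a ∨ c u = b) :
    KempeConnOn G Set.univ c a b u u :=
  ⟨Walk.nil, by simpa using h⟩

theorem KempeConnOn.step_univ {c : V → Fin 4} {a b : Fin 4} {u v w : V}
    (h : KempeConnOn G Set.univ c a b u v) (hvw : G.Adj v w) (hw : c w = a ∨ c w = b) :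
    KempeConnOn G Set.univ c a b u w := by
  obtain ⟨p, hp⟩ := h
  refine ⟨p.concat hvw, fun x hx => ⟨trivial, ?_⟩⟩
  rw [Walk.support_concat, List.mem_append, List.mem_singleton] at hx
  rcases hx with hx | rfl
  exacts [(hp x hx).2, hw]

open Classical in
/-- Swap the colors `a` and `b` on the Kempe chain of `u`. -/
noncomputable def kempeSwap (G : SimpleGraph V) (c : V → Fin 4) (a b : Fin 4) (u : V) :
    V → Fin 4 :=
  fun v => if KempeConnOn G Set.univ c a b u v then Equiv.swap a b (c v) else c v

theorem kempeSwap_of_not_conn {c : V → Fin 4} {a b : Fin 4} {u v : V}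
    (h : ¬ KempeConnOn G Set.univ c a b u v) : kempeSwap G c a b u v = c v :=
  if_neg h

theorem kempeSwap_of_conn {c : V → Fin 4} {a b : Fin 4} {u v : V}
    (h : KempeConnOn G Set.univ c a b u v) : kempeSwap G c a b u v = Equiv.swap a b (c v) :=
  if_pos h

theorem kempeSwap_of_ne {c : V → Fin 4} {a b : Fin 4} {u v : V}
    (ha : c v ≠ a) (hb : c v ≠ b) : kempeSwap G c a b u v = c v :=
  kempeSwap_of_not_conn fun h => h.color_right.elim ha hb

theorem isSingleKempeChange_kempeSwap {c : V → Fin 4} {a b : Fin 4} {u : V} (hab : a ≠ b)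
    (hu : c u = a ∨ c u = b) : IsSingleKempeChange G c (kempeSwap G c a b u) := by
  refine ⟨a, b, hab, u, hu, fun v => ⟨fun h => ?_, kempeSwap_of_not_conn⟩⟩
  rw [kempeSwap_of_conn h]
  rcases h.color_right with h | h <;> simp [h]

theorem IsProperColoring.kempeSwap {c : V → Fin 4} (hc : IsProperColoring G c) (a b : Fin 4)
    (u : V) : IsProperColoring G (kempeSwap G c a b u) := by
  have key : ∀ v w, G.Adj v w → KempeConnOn G Set.univ c a b u v →
      FourColor.kempeSwap G c a b u v ≠ FourColor.kempeSwap G c a b u w := by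
    intro v w hvw hv
    by_cases hw : KempeConnOn G Set.univ c a b u w
    · rw [kempeSwap_of_conn hv, kempeSwap_of_conn hw]
      exact fun h => hc hvw ((Equiv.swap a b).injective h)
    · have hwa : ¬ (c w = a ∨ c w = b) := fun h => hw (hv.step_univ hvw h)
      rw [kempeSwap_of_conn hv, kempeSwap_of_not_conn hw]
      intro h
      rcases hv.color_right with h' | h' <;> rw [h'] at h
      · rw [Equiv.swap_apply_left] at h
        exact hwa (Or.inr h.symm)
      · rw [Equiv.swap_apply_right] at h
        exact hwa (Or.inl h.symm)
  intro v w hvw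
  by_cases hv : KempeConnOn G Set.univ c a b u v
  · exact key v w hvw hv
  by_cases hw : KempeConnOn G Set.univ c a b u w
  · exact (key w v hvw.symm hw).symm
  · rw [kempeSwap_of_not_conn hv, kempeSwap_of_not_conn hw]
    exact hc hvw

theorem IsSingleKempeChange.symm {c c' : V → Fin 4} (h : IsSingleKempeChange G c c') :
    IsSingleKempeChange G c' c := by
  obtain ⟨a, b, hab, u, hu, h⟩ := h
  have hcol : ∀ v, (c' v = a ∨ c' v = b) ↔ (c v = a ∨ c v = b) := by
    intro v
    by_cases hv : KempeConnOn G Set.univ c a b u v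
    · rcases (h v).1 hv with ⟨h₁, h₂⟩ | ⟨h₁, h₂⟩ <;> simp [h₁, h₂]
    · rw [(h v).2 hv]
  have hconn : ∀ v, KempeConnOn G Set.univ c' a b u v ↔ KempeConnOn G Set.univ c a b u v := by
    intro v
    simp only [KempeConnOn, hcol]
  refine ⟨a, b, hab, u, (hcol u).2 hu, fun v => ⟨fun hv => ?_, fun hv => ?_⟩⟩
  · rcases (h v).1 ((hconn v).1 hv) with ⟨h₁, h₂⟩ | ⟨h₁, h₂⟩
    exacts [Or.inr ⟨h₂, h₁⟩, Or.inl ⟨h₂, h₁⟩]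
  · exact ((h v).2 (fun h' => hv ((hconn v).2 h'))).symm

/-- On a noncrossing 5-cycle whose color classes for two complementary pairs alternate, one of
two Kempe changes affects a single vertex of the cycle. -/
theorem RingNoncrossing.exists_kempeChange {rv : Fin 5 → V} (hnc : RingNoncrossing G rv)
    (hadj : ∀ i : Fin 5, G.Adj (rv i) (rv (i + 1))) {c : V → Fin 4}
    (hc : IsProperColoring G c) (i : Fin 5) {a b e f : Fin 4} (hab : a ≠ b) (hef : e ≠ f)
    (hae : a ≠ e) (haf : a ≠ f) (hbe : b ≠ e) (hbf : b ≠ f)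
    (h₀ : c (rv i) = a ∨ c (rv i) = b) (h₁ : c (rv (i + 1)) = a ∨ c (rv (i + 1)) = b)
    (h₂ : c (rv (i + 2)) = e) (h₃ : c (rv (i + 3)) = b)
    (h₄ : c (rv (i + 4)) = e ∨ c (rv (i + 4)) = f) :
    ∃ c', IsSingleKempeChange G c c' ∧ IsProperColoring G c' ∧
      c' (rv i) = c (rv i) ∧ c' (rv (i + 1)) = c (rv (i + 1)) ∧
      c' (rv (i + 4)) = c (rv (i + 4)) ∧
      ((c' (rv (i + 2)) = e ∧ c' (rv (i + 3)) = a) ∨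
        (c' (rv (i + 2)) = f ∧ c' (rv (i + 3)) = b)) := by
  by_cases h : KempeConnOn G Set.univ c a b (rv (i + 3)) (rv (i + 1))
  · have hn : ¬ KempeConnOn G Set.univ c e f (rv (i + 2)) (rv (i + 4)) := by
      rintro ⟨q, hq⟩
      obtain ⟨p, hp⟩ := h
      obtain ⟨x, hx, hx'⟩ := hnc i p.reverse q
      rw [Walk.support_reverse, List.mem_reverse] at hx
      rcases (hp x hx).2 with h | h <;> rcases (hq x hx').2 with h' | h'
      exacts [hae (h.symm.trans h'), haf (h.symm.trans h'), hbe (h.symm.trans h'),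
        hbf (h.symm.trans h')]
    have hfix : ∀ {v}, (c v = a ∨ c v = b) → kempeSwap G c e f (rv (i + 2)) v = c v := by
      rintro v (h | h) <;> exact kempeSwap_of_ne (by rwa [h]) (by rwa [h])
    refine ⟨_, isSingleKempeChange_kempeSwap hef (Or.inl h₂), hc.kempeSwap e f _, hfix h₀,
      hfix h₁, kempeSwap_of_not_conn hn, Or.inr ⟨?_, ?_⟩⟩
    · rw [kempeSwap_of_conn (KempeConnOn.refl_univ (Or.inl h₂)), h₂, Equiv.swap_apply_left]
    · rw [hfix (Or.inr h₃), h₃]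
  · have hfix : ∀ {v}, (c v = e ∨ c v = f) → kempeSwap G c a b (rv (i + 3)) v = c v := by
      rintro v (h | h) <;> refine kempeSwap_of_ne ?_ ?_ <;> rw [h] <;> apply Ne.symm <;>
        assumption
    refine ⟨_, isSingleKempeChange_kempeSwap hab (Or.inr h₃), hc.kempeSwap a b _,
      kempeSwap_of_not_conn fun h' => h (h'.step_univ (hadj i) h₁), kempeSwap_of_not_conn h,
      hfix h₄, Or.inl ⟨?_, ?_⟩⟩
    · rw [hfix (Or.inl h₂), h₂]
    · rw [kempeSwap_of_conn (KempeConnOn.refl_univ (Or.inr h₃)), h₃, Equiv.swap_apply_right]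

end KempeSwap

section PentagonColorings

/-- A 3-coloring of the pentagon in which `j` is the only vertex of its color. -/
def IsSolo (j : Fin 5) (κ : Fin 5 → Fin 4) : Prop :=
  κ (j + 1) = κ (j + 3) ∧ κ (j + 2) = κ (j + 4) ∧
    κ j ≠ κ (j + 1) ∧ κ j ≠ κ (j + 2) ∧ κ (j + 1) ≠ κ (j + 2)

/-- A 4-coloring of the pentagon using all colors in which both neighbors of `j` agree. -/
def IsPair (j : Fin 5) (κ : Fin 5 → Fin 4) : Prop :=
  κ (j + 1) = κ (j + 4) ∧ κ j ≠ κ (j + 1) ∧ κ j ≠ κ (j + 2) ∧ κ j ≠ κ (j + 3) ∧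
    κ (j + 1) ≠ κ (j + 2) ∧ κ (j + 1) ≠ κ (j + 3) ∧ κ (j + 2) ≠ κ (j + 3)

theorem colorPermEq_of_forall_iff {α : Type} {κ κ' : α → Fin 4}
    (h : ∀ x y, κ x = κ y ↔ κ' x = κ' y) : ColorPermEq κ κ' := by
  classical
  let e : {a // a ∈ Set.range κ} ≃ {a // a ∈ Set.range κ'} :=
    (Setoid.quotientKerEquivRange κ).symm.trans
      ((Quotient.congrRight h).trans (Setoid.quotientKerEquivRange κ'))
  refine ⟨e.extendSubtype, fun x => ?_⟩
  rw [Equiv.extendSubtype_apply_of_mem e (κ x) ⟨x, rfl⟩]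
  have : (Setoid.quotientKerEquivRange κ).symm ⟨κ x, x, rfl⟩ = Quotient.mk _ x := by
    rw [Equiv.symm_apply_eq]; rfl
  simp only [e, Equiv.trans_apply, this]
  rfl

theorem IsSolo.colorPermEq {j : Fin 5} {κ κ' : Fin 5 → Fin 4} (h : IsSolo j κ)
    (h' : IsSolo j κ') : ColorPermEq κ κ' := by
  refine colorPermEq_of_forall_iff fun x y => ?_
  obtain ⟨x, rfl⟩ : ∃ x', x = j + x' := ⟨x - j, by abel⟩
  obtain ⟨y, rfl⟩ : ∃ y', y = j + y' := ⟨y - j, by abel⟩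
  unfold IsSolo at h h'
  fin_cases x <;> fin_cases y <;> simp <;> grind

theorem IsPair.colorPermEq {j : Fin 5} {κ κ' : Fin 5 → Fin 4} (h : IsPair j κ)
    (h' : IsPair j κ') : ColorPermEq κ κ' := by
  refine colorPermEq_of_forall_iff fun x y => ?_
  obtain ⟨x, rfl⟩ : ∃ x', x = j + x' := ⟨x - j, by abel⟩
  obtain ⟨y, rfl⟩ : ∃ y', y = j + y' := ⟨y - j, by abel⟩
  unfold IsPair at h h'
  fin_cases x <;> fin_cases y <;> simp <;> grind

theorem isSolo_or_isPair_of_unique {j : Fin 5} {κ : Fin 5 → Fin 4} (h : ∀ i, κ i ≠ κ (i + 1))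
    (hj : ∀ i, κ i = κ j → i = j) :
    IsSolo j κ ∨ IsPair j κ ∨ IsPair (j + 2) κ ∨ IsPair (j + 3) κ := by
  revert j κ
  unfold IsSolo IsPair
  decide +kernel

theorem isSolo_or_isPair_of_eq {j : Fin 5} {κ : Fin 5 → Fin 4} (h : ∀ i, κ i ≠ κ (i + 1))
    (hj : κ j = κ (j + 2)) : IsPair (j + 1) κ ∨ IsSolo (j + 3) κ ∨ IsSolo (j + 4) κ := by
  revert j κ
  unfold IsSolo IsPair
  decide +kernel

theorem exists_isSolo {κ : Fin 5 → Fin 4} (h : ∀ i, κ i ≠ κ (i + 1))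
    (hκ : (Finset.image κ Finset.univ).card = 3) : ∃ j, IsSolo j κ := by
  revert κ
  unfold IsSolo
  decide +kernel

end PentagonColorings

section Moves

variable {V : Type} {G : SimpleGraph V} {rv : Fin 5 → V}

theorem exists_fourth_color : ∀ a b c : Fin 4, ∃ d, d ≠ a ∧ d ≠ b ∧ d ≠ c := by
  decide

theorem RingNoncrossing.isSolo_forward (hnc : RingNoncrossing G rv)
    (hadj : ∀ i : Fin 5, G.Adj (rv i) (rv (i + 1))) {c : V → Fin 4}
    (hc : IsProperColoring G c) {j : Fin 5} (hj : IsSolo j (fun i => c (rv i))) :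
    ∃ c', IsSingleKempeChange G c c' ∧ IsProperColoring G c' ∧
      (IsSolo (j + 1) (fun i => c' (rv i)) ∨ IsPair (j + 2) (fun i => c' (rv i))) := by
  obtain ⟨h₁, h₂, h₃, h₄, h₅⟩ := hj
  obtain ⟨f, hf₁, hf₂, hf₃⟩ := exists_fourth_color (c (rv j)) (c (rv (j + 1))) (c (rv (j + 2)))
  obtain ⟨c', hk, hc', h⟩ := hnc.exists_kempeChange hadj hc j h₃ hf₃.symm h₄ hf₁.symm h₅ hf₂.symm
    (Or.inl rfl) (Or.inr rfl) rfl h₁.symm (Or.inl h₂.symm)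
  refine ⟨c', hk, hc', ?_⟩
  simp only [IsSolo, IsPair, add_assoc, Fin.reduceAdd, add_zero]
  grind

theorem RingNoncrossing.isSolo_backward (hnc : RingNoncrossing G rv)
    (hadj : ∀ i : Fin 5, G.Adj (rv i) (rv (i + 1))) {c : V → Fin 4}
    (hc : IsProperColoring G c) {j : Fin 5} (hj : IsSolo j (fun i => c (rv i))) :
    ∃ c', IsSingleKempeChange G c c' ∧ IsProperColoring G c' ∧
      (IsSolo (j + 4) (fun i => c' (rv i)) ∨ IsPair (j + 3) (fun i => c' (rv i))) := by
  obtain ⟨h₁, h₂, h₃, h₄, h₅⟩ := hj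
  obtain ⟨f, hf₁, hf₂, hf₃⟩ := exists_fourth_color (c (rv j)) (c (rv (j + 1))) (c (rv (j + 2)))
  have hstep := hnc.exists_kempeChange hadj hc (j + 4) (a := c (rv j)) (b := c (rv (j + 2)))
    (e := c (rv (j + 1))) (f := f)
  simp only [add_assoc, Fin.reduceAdd, add_zero] at hstep
  obtain ⟨c', hk, hc', h⟩ := hstep h₄ hf₂.symm h₃ hf₁.symm h₅.symm hf₃.symm
    (Or.inr h₂.symm) (Or.inl trivial) trivial trivial (Or.inl h₁.symm)
  refine ⟨c', hk, hc', ?_⟩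
  simp only [IsSolo, IsPair, add_assoc, Fin.reduceAdd, add_zero]
  grind

theorem RingNoncrossing.isPair_forward (hnc : RingNoncrossing G rv)
    (hadj : ∀ i : Fin 5, G.Adj (rv i) (rv (i + 1))) {c : V → Fin 4}
    (hc : IsProperColoring G c) {j : Fin 5} (hj : IsPair j (fun i => c (rv i))) :
    ∃ c', IsSingleKempeChange G c c' ∧ IsProperColoring G c' ∧
      (IsPair (j + 2) (fun i => c' (rv i)) ∨ IsSolo (j + 3) (fun i => c' (rv i))) := by
  obtain ⟨h₁, h₂, h₃, h₄, h₅, h₆, h₇⟩ := hj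
  have hstep := hnc.exists_kempeChange hadj hc (j + 3) (a := c (rv (j + 3)))
    (b := c (rv (j + 1))) (e := c (rv j)) (f := c (rv (j + 2)))
  simp only [add_assoc, Fin.reduceAdd, add_zero] at hstep
  obtain ⟨c', hk, hc', h⟩ := hstep h₆.symm h₃ h₄.symm h₇.symm h₂.symm h₅
    (Or.inl trivial) (Or.inr h₁.symm) trivial trivial (Or.inr trivial)
  refine ⟨c', hk, hc', ?_⟩
  simp only [IsSolo, IsPair, add_assoc, Fin.reduceAdd, add_zero]
  grind

/-- The three outcomes for a list of colorings: (i) all ring colorings with a fixed singleton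
color class, (ii) all ring colorings with a fixed pair of equal vertices, or (iii) all
3-colorings of the ring occur. -/
def RingOutcome (rv : Fin 5 → V) (l : List (V → Fin 4)) : Prop :=
  (∃ j : Fin 5, ∀ κ : Fin 5 → Fin 4,
    (∀ i : Fin 5, κ i ≠ κ (i + 1)) → (∀ i : Fin 5, κ i = κ j → i = j) →
    ∃ d ∈ l, ColorPermEq κ (fun i => d (rv i))) ∨
  (∃ j : Fin 5, ∀ κ : Fin 5 → Fin 4,
    (∀ i : Fin 5, κ i ≠ κ (i + 1)) → κ j = κ (j + 2) →
    ∃ d ∈ l, ColorPermEq κ (fun i => d (rv i))) ∨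
  (∀ κ : Fin 5 → Fin 4,
    (∀ i : Fin 5, κ i ≠ κ (i + 1)) →
    (Finset.image κ Finset.univ).card = 3 →
    ∃ d ∈ l, ColorPermEq κ (fun i => d (rv i)))

theorem ringOutcome_of_unique {l : List (V → Fin 4)} (j : Fin 5)
    (h₁ : ∃ d ∈ l, IsSolo j (fun i => d (rv i))) (h₂ : ∃ d ∈ l, IsPair j (fun i => d (rv i)))
    (h₃ : ∃ d ∈ l, IsPair (j + 2) (fun i => d (rv i)))
    (h₄ : ∃ d ∈ l, IsPair (j + 3) (fun i => d (rv i))) : RingOutcome rv l := by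
  refine Or.inl ⟨j, fun κ hκ hj => ?_⟩
  rcases isSolo_or_isPair_of_unique hκ hj with h | h | h | h
  · exact h₁.imp fun d hd => ⟨hd.1, h.colorPermEq hd.2⟩
  · exact h₂.imp fun d hd => ⟨hd.1, h.colorPermEq hd.2⟩
  · exact h₃.imp fun d hd => ⟨hd.1, h.colorPermEq hd.2⟩
  · exact h₄.imp fun d hd => ⟨hd.1, h.colorPermEq hd.2⟩

theorem ringOutcome_of_pair {l : List (V → Fin 4)} (j : Fin 5)
    (h₁ : ∃ d ∈ l, IsSolo j (fun i => d (rv i)))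
    (h₂ : ∃ d ∈ l, IsSolo (j + 1) (fun i => d (rv i)))
    (h₃ : ∃ d ∈ l, IsPair (j + 3) (fun i => d (rv i))) : RingOutcome rv l := by
  refine Or.inr (Or.inl ⟨j + 2, fun κ hκ hj => ?_⟩)
  have h := isSolo_or_isPair_of_eq hκ hj
  simp only [add_assoc, Fin.reduceAdd, add_zero] at h
  rcases h with h | h | h
  · exact h₃.imp fun d hd => ⟨hd.1, h.colorPermEq hd.2⟩
  · exact h₁.imp fun d hd => ⟨hd.1, h.colorPermEq hd.2⟩
  · exact h₂.imp fun d hd => ⟨hd.1, h.colorPermEq hd.2⟩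

theorem ringOutcome_of_forall_isSolo {l : List (V → Fin 4)}
    (h : ∀ j, ∃ d ∈ l, IsSolo j (fun i => d (rv i))) : RingOutcome rv l := by
  refine Or.inr (Or.inr fun κ hκ hcard => ?_)
  obtain ⟨j, hj⟩ := exists_isSolo hκ hcard
  exact (h j).imp fun d hd => ⟨hd.1, hj.colorPermEq hd.2⟩

/-- At most four Kempe changes suffice on a noncrossing 5-cycle. -/
theorem RingNoncrossing.exists_kempeChanges (hnc : RingNoncrossing G rv)
    (hadj : ∀ i : Fin 5, G.Adj (rv i) (rv (i + 1))) {c : V → Fin 4}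
    (hc : IsProperColoring G c)
    (hcard : (Finset.image (fun i : Fin 5 => c (rv i)) Finset.univ).card = 3) :
    ∃ cs : List (V → Fin 4), cs.length ≤ 4 ∧ (c :: cs).IsChain (IsSingleKempeChange G) ∧
      (∀ d ∈ cs, IsProperColoring G d) ∧ RingOutcome rv (c :: cs) := by
  obtain ⟨j, hj⟩ := exists_isSolo (fun i => hc (hadj i)) hcard
  obtain ⟨c₁, hk₁, hc₁, hj₁ | hj₁⟩ := hnc.isSolo_forward hadj hc hj
  · obtain ⟨c₂, hk₂, hc₂, hj₂ | hj₂⟩ := hnc.isSolo_forward hadj hc₁ hj₁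
    · obtain ⟨c₃, hk₃, hc₃, hj₃ | hj₃⟩ := hnc.isSolo_forward hadj hc₂ hj₂
      · obtain ⟨c₄, hk₄, hc₄, hj₄ | hj₄⟩ := hnc.isSolo_forward hadj hc₃ hj₃ <;>
          refine ⟨[c₁, c₂, c₃, c₄], by simp, by simp [*], by simp [*], ?_⟩ <;>
          simp only [add_assoc, Fin.reduceAdd, add_zero] at hj₂ hj₃ hj₄
        · refine ringOutcome_of_forall_isSolo fun k => ?_
          obtain ⟨k, rfl⟩ : ∃ k', k = j + k' := ⟨k - j, by abel⟩
          fin_cases k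
          · exact ⟨c, by simp, by simpa using hj⟩
          · exact ⟨c₁, by simp, hj₁⟩
          · exact ⟨c₂, by simp, hj₂⟩
          · exact ⟨c₃, by simp, hj₃⟩
          · exact ⟨c₄, by simp, hj₄⟩
        · refine ringOutcome_of_pair (j + 2) ⟨c₂, by simp, hj₂⟩ ⟨c₃, by simp, ?_⟩
            ⟨c₄, by simp, ?_⟩ <;> simpa only [add_assoc, Fin.reduceAdd, add_zero]
      · refine ⟨[c₁, c₂, c₃], by simp, by simp [*], by simp [*], ?_⟩
        simp only [add_assoc, Fin.reduceAdd] at hj₂ hj₃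
        refine ringOutcome_of_pair (j + 1) ⟨c₁, by simp, hj₁⟩ ⟨c₂, by simp, ?_⟩
            ⟨c₃, by simp, ?_⟩ <;> simpa only [add_assoc, Fin.reduceAdd]
    · refine ⟨[c₁, c₂], by simp, by simp [*], by simp [*], ?_⟩
      simp only [add_assoc, Fin.reduceAdd] at hj₂
      exact ringOutcome_of_pair j ⟨c, by simp, hj⟩ ⟨c₁, by simp, hj₁⟩ ⟨c₂, by simp, hj₂⟩
  · have hk₁' := hk₁.symm
    obtain ⟨c₂, hk₂, hc₂, hj₂ | hj₂⟩ := hnc.isSolo_backward hadj hc hj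
    · refine ⟨[c₁, c, c₂], by simp, by simp [*], by simp [*], ?_⟩
      refine ringOutcome_of_pair (j + 4) ⟨c₂, by simp, hj₂⟩ ⟨c, by simp, ?_⟩
        ⟨c₁, by simp, ?_⟩ <;> simpa only [add_assoc, Fin.reduceAdd, add_zero]
    · obtain ⟨c₃, hk₃, hc₃, hj₃ | hj₃⟩ := hnc.isPair_forward hadj hc₂ hj₂ <;>
        refine ⟨[c₁, c, c₂, c₃], by simp, by simp [*], by simp [*], ?_⟩ <;>
        simp only [add_assoc, Fin.reduceAdd, add_zero] at hj₃
      · exact ringOutcome_of_unique j ⟨c, by simp, hj⟩ ⟨c₃, by simp, hj₃⟩ ⟨c₁, by simp, hj₁⟩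
          ⟨c₂, by simp, hj₂⟩
      · exact ringOutcome_of_pair j ⟨c, by simp, hj⟩ ⟨c₃, by simp, hj₃⟩ ⟨c₂, by simp, hj₂⟩

end Moves

end FourColor

open FourColor in
/-- Let `H` be a near-triangulation whose outer face is
bounded by the 5-cycle `R = v₀…v₄` (0-indexed), with a proper 4-coloring in
which exactly three colors appear on `R`.  Using at most six single Kempe
changes (in time linear in `|H|`, modelled by the step count), one can either
(i) find `j` and produce all four 4-colorings of `R` (up to permutation of
colors) in which `v_j` is the only vertex of its color, or (ii) find `j` and
produce all three 4-colorings of `R` in which `v_j` and `v_{j+2}` receive the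
same color, or (iii) produce all five 3-colorings of `R`. -/
theorem kempe_changes_five_ring :
    ∃ K : ℕ,
      ∀ (V : Type) [Fintype V] (N : NearTriangulation V) (rv : Fin 5 → V),
        Function.Injective rv →
        (∀ i : Fin 5, N.graph.Adj (rv i) (rv (i + 1))) →
        (∀ x : V, N.OnOuter x ↔ ∃ i : Fin 5, rv i = x) →
        (∀ d d' : N.graph.Dart, N.isOuter d → N.isOuter d' →
          d.toProd.1 = d'.toProd.1 → d = d') →
        ∀ c : V → Fin 4, IsProperColoring N.graph c →
        (Finset.image (fun i : Fin 5 => c (rv i)) Finset.univ).card = 3 →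
        ∃ (cs : List (V → Fin 4)) (steps : ℕ),
          cs.length ≤ 6 ∧ steps ≤ K * Fintype.card V ∧
          List.Chain (IsSingleKempeChange N.graph) c cs ∧
          (∀ d ∈ cs, IsProperColoring N.graph d) ∧
          ((∃ j : Fin 5, ∀ κ : Fin 5 → Fin 4,
              (∀ i : Fin 5, κ i ≠ κ (i + 1)) → (∀ i : Fin 5, κ i = κ j → i = j) →
              ∃ d ∈ c :: cs, ColorPermEq κ (fun i => d (rv i))) ∨
           (∃ j : Fin 5, ∀ κ : Fin 5 → Fin 4,
              (∀ i : Fin 5, κ i ≠ κ (i + 1)) → κ j = κ (j + 2) →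
              ∃ d ∈ c :: cs, ColorPermEq κ (fun i => d (rv i))) ∨
           (∀ κ : Fin 5 → Fin 4,
              (∀ i : Fin 5, κ i ≠ κ (i + 1)) →
              (Finset.image κ Finset.univ).card = 3 →
              ∃ d ∈ c :: cs, ColorPermEq κ (fun i => d (rv i)))) := by
  refine ⟨0, fun V _ N rv hinj hadj hout hsimple c hc hcard => ?_⟩
  obtain ⟨cs, hlen, hchain, hproper, h⟩ :=
    (N.ringNoncrossing rv hinj hadj hout hsimple).exists_kempeChanges hadj hc hcard
  exact ⟨cs, 0, by omega, by simp, hchain, hproper, h⟩
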